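/- arXiv:1605.02915 — 2 statements merged into one kernel-verified Lean document; each statement's English description precedes it below -/
import Mathlib

section
/- Let n≥1 and let [[a,b],[c,d]]∈SL(2,ℤ) with c divisible by 3 and (a,b,c,d)≡(1,0,0,1) mod 2, and let τ lie in the upper half-plane. Then there exists a constant C, independent of z₁,…,z_{2n} (it may depend on n, a, b, c, d, τ), such that for all z₁,…,z_{2n}∈ℂ: P_n^{(1)}(z₁/(cτ+d),…,z_{2n}/(cτ+d); (aτ+b)/(cτ+d)) = C·exp((3iπc/(cτ+d))·Σ_{1≤i<j≤2n}(z_i−z_j)²)·P_n^{(1)}(z₁,…,z_{2n};τ). Likewise, if instead d is divisible by 3 and (a,b,c,d)≡(1,0,0,1) mod 2, the same identity holds with P_n^{(1)} on the right-hand side replaced by P_n^{(3)}. -/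
open Complex BigOperators Finset

noncomputable section

def qpoch (a p : ℂ) : ℂ := ∏' j : ℕ, (1 - a * p ^ j)

def theta (x p : ℂ) : ℂ := qpoch x p * qpoch (p / x) p

def pf {m : ℕ} (A : Matrix (Fin (2 * m)) (Fin (2 * m)) ℂ) : ℂ :=
  (1 / (2 ^ m * (Nat.factorial m) : ℂ)) *
    ∑ σ : Equiv.Perm (Fin (2 * m)), ((Equiv.Perm.sign σ : ℤ) : ℂ) *
      ∏ j : Fin m, A (σ ⟨2 * (j : ℕ), by have := j.isLt; omega⟩)
        (σ ⟨2 * (j : ℕ) + 1, by have := j.isLt; omega⟩)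

def pPow (τ lam : ℂ) : ℂ := Complex.exp (Real.pi * Complex.I * τ * lam)

def xOf (z : ℂ) : ℂ := Complex.exp (Real.pi * Complex.I * z)

def P1 (n : ℕ) (τ : ℂ) (z : Fin (2 * n) → ℂ) : ℂ :=
  let p : ℂ → ℂ := fun lam => pPow τ lam
  let x : Fin (2 * n) → ℂ := fun j => xOf (z j)
  (∏ i, ∏ j, if i < j then
      (x j) ^ 3 / (x i) ^ 3 * theta (-((x i) ^ 6 / (x j) ^ 6)) (p 6) else 1) *
  pf (fun i j => x i / x j *
      theta ((x i) ^ 2 / (x j) ^ 2) (p 2) * theta (-((x i) ^ 2 / (x j) ^ 2)) (p 2) *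
      theta (p 1 * ((x i) ^ 2 / (x j) ^ 2)) (p 2) /
      theta (-((x i) ^ 6 / (x j) ^ 6)) (p 6))

def P3 (n : ℕ) (τ : ℂ) (z : Fin (2 * n) → ℂ) : ℂ :=
  let p : ℂ → ℂ := fun lam => pPow τ lam
  let x : Fin (2 * n) → ℂ := fun j => xOf (z j)
  (∏ i, ∏ j, if i < j then
      x j / x i * theta (-((x i) ^ 2 / (x j) ^ 2)) (p (2/3)) else 1) *
  pf (fun i j => x j / x i *
      theta ((x i) ^ 2 / (x j) ^ 2) (p 2) * theta (-((x i) ^ 2 / (x j) ^ 2)) (p 2) *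
      theta (p 1 * ((x i) ^ 2 / (x j) ^ 2)) (p 2) /
      theta (-((x i) ^ 2 / (x j) ^ 2)) (p (2/3)))

/-! ### Quotients of quasi-periodic entire functions -/

lemma exists_differentiable_quotient {f g : ℂ → ℂ} (hf : Differentiable ℂ f)
    (hg : Differentiable ℂ g) (h : ∀ u, g u = 0 → f u = 0 ∧ deriv g u ≠ 0) :
    ∃ q : ℂ → ℂ, Differentiable ℂ q ∧ ∀ u, f u = q u * g u := by
  classical
  refine ⟨fun u => if g u = 0 then deriv f u / deriv g u else f u / g u, fun u₀ => ?_,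
    fun u => ?_⟩
  · by_cases h0 : g u₀ = 0
    · obtain ⟨hf0, hg0⟩ := h u₀ h0
      have hdf : DifferentiableAt ℂ (dslope f u₀) u₀ :=
        ((Complex.differentiableOn_dslope Filter.univ_mem).2 hf.differentiableOn).differentiableAt
          Filter.univ_mem
      have hdg : DifferentiableAt ℂ (dslope g u₀) u₀ :=
        ((Complex.differentiableOn_dslope Filter.univ_mem).2 hg.differentiableOn).differentiableAt
          Filter.univ_mem
      have hne : dslope g u₀ u₀ ≠ 0 := by rwa [dslope_same]
      refine (hdf.div hdg hne).congr_of_eventuallyEq ?_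
      filter_upwards [hdg.continuousAt.eventually_ne hne] with u hu
      rcases eq_or_ne u u₀ with rfl | huu
      · simp [h0]
      · have hsub : u - u₀ ≠ 0 := sub_ne_zero.2 huu
        rw [dslope_of_ne _ huu, slope_def_field, h0, sub_zero] at hu
        have hgu : g u ≠ 0 := fun h' => hu (by simp [h'])
        simp only [Pi.div_apply]
        rw [if_neg hgu, dslope_of_ne _ huu, dslope_of_ne _ huu, slope_def_field, slope_def_field,
          h0, hf0, sub_zero, sub_zero]
        field_simp
    · refine ((hf u₀).div (hg u₀) h0).congr_of_eventuallyEq ?_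
      filter_upwards [(hg u₀).continuousAt.eventually_ne h0] with u hu
      simp [hu]
  · by_cases h0 : g u = 0
    · simp [h0, (h u h0).1]
    · simp [h0]

lemma periodic_quotient {f g q e : ℂ → ℂ} {w : ℂ} (hg : Differentiable ℂ g)
    (hq : Differentiable ℂ q) (hg0 : ∃ u, g u ≠ 0) (hfg : ∀ u, f u = q u * g u)
    (hfw : ∀ u, f (u + w) = e u * f u) (hgw : ∀ u, g (u + w) = e u * g u) :
    Function.Periodic q w := by
  have hqw : Differentiable ℂ fun u => q (u + w) - q u :=
    (hq.comp (differentiable_id.add_const w)).sub hq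
  have hgw' : Differentiable ℂ fun u => g (u + w) := hg.comp (differentiable_id.add_const w)
  have hmul : ∀ u ∈ Set.univ, (q (u + w) - q u) * g (u + w) = 0 := fun u _ => by
    rw [sub_mul, ← hfg, hfw, hfg, hgw]; ring
  rcases AnalyticOnNhd.eq_zero_or_eq_zero_of_mul_eq_zero
    (fun u _ => hqw.analyticAt u) (fun u _ => hgw'.analyticAt u) hmul isPreconnected_univ
    with h | h
  · exact fun u => sub_eq_zero.1 (h u trivial)
  · obtain ⟨u, hu⟩ := hg0
    exact absurd (by simpa using h (u - w) trivial) hu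

lemma linearIndependent_one_of_im_pos {τ : ℂ} (hτ : 0 < τ.im) :
    LinearIndependent ℝ ![(1 : ℂ), τ] := by
  rw [LinearIndependent.pair_iff]
  intro s t h
  have him := congrArg Complex.im h
  have hre := congrArg Complex.re h
  simp at him hre
  have ht : t = 0 := him.resolve_right hτ.ne'
  simpa [ht] using hre

lemma eq_const_of_doubly_periodic {q : ℂ → ℂ} (hq : Differentiable ℂ q) {τ : ℂ}
    (hτ : 0 < τ.im) (h1 : Function.Periodic q 1) (h2 : Function.Periodic q τ) (u : ℂ) :
    q u = q 0 := by
  let L : PeriodPair := ⟨1, τ, linearIndependent_one_of_im_pos hτ⟩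
  refine hq.apply_eq_apply_of_bounded
    (IsZLattice.isCompact_range_of_periodic L.lattice q hq.continuous fun z w hw => ?_).isBounded
    u 0
  obtain ⟨m, k, rfl⟩ := PeriodPair.mem_lattice.1 hw
  rw [← add_assoc, (h2.int_mul k) _, (h1.int_mul m) _]

lemma exists_eq_const_mul {f g e₁ e₂ : ℂ → ℂ} {τ : ℂ} (hτ : 0 < τ.im) (hf : Differentiable ℂ f)
    (hg : Differentiable ℂ g) (hg0 : ∃ u, g u ≠ 0)
    (h : ∀ u, g u = 0 → f u = 0 ∧ deriv g u ≠ 0)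
    (hf1 : ∀ u, f (u + 1) = e₁ u * f u) (hg1 : ∀ u, g (u + 1) = e₁ u * g u)
    (hf2 : ∀ u, f (u + τ) = e₂ u * f u) (hg2 : ∀ u, g (u + τ) = e₂ u * g u) :
    ∃ C, ∀ u, f u = C * g u := by
  obtain ⟨q, hq, hfg⟩ := exists_differentiable_quotient hf hg h
  refine ⟨q 0, fun u => ?_⟩
  rw [hfg, eq_const_of_doubly_periodic hq hτ (periodic_quotient hg hq hg0 hfg hf1 hg1)
    (periodic_quotient hg hq hg0 hfg hf2 hg2)]

/-! ### The infinite product and the multiplicative theta function -/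

section Products

variable {p : ℂ}

lemma summable_norm_mul_pow (hp : ‖p‖ < 1) (a : ℂ) : Summable fun j : ℕ => ‖-(a * p ^ j)‖ := by
  simpa using (summable_geometric_of_lt_one (norm_nonneg p) hp).mul_left ‖a‖

lemma qpoch_ne_zero (hp : ‖p‖ < 1) {a : ℂ} (h : ∀ j : ℕ, a * p ^ j ≠ 1) : qpoch a p ≠ 0 := by
  have := tprod_one_add_ne_zero_of_summable (f := fun j : ℕ => -(a * p ^ j))
    (fun j => by rw [← sub_eq_add_neg]; exact sub_ne_zero.2 (h j).symm)
    (summable_norm_mul_pow hp a)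
  simpa only [qpoch, sub_eq_add_neg] using this

lemma qpoch_eq_one_sub_mul (hp : ‖p‖ < 1) (a : ℂ) : qpoch a p = (1 - a) * qpoch (p * a) p := by
  have hshift : ∀ j : ℕ, 1 - a * p ^ (j + 1) = 1 - p * a * p ^ j := fun j => by ring
  have hm : Multipliable fun j : ℕ => 1 - a * p ^ (j + 1) := by
    simpa only [hshift, sub_eq_add_neg] using
      multipliable_one_add_of_summable (summable_norm_mul_pow hp (p * a))
  have h := tprod_eq_zero_mul' (f := fun j : ℕ => 1 - a * p ^ j) hm
  rw [pow_zero, mul_one, tprod_congr hshift] at h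
  exact h

lemma differentiable_qpoch (hp : ‖p‖ < 1) : Differentiable ℂ fun a => qpoch a p := by
  intro a₀
  have hopen : IsOpen (Metric.ball (0 : ℂ) (‖a₀‖ + 1)) := Metric.isOpen_ball
  have hprod := Summable.hasProdLocallyUniformlyOn_nat_one_add (f := fun j a => -(a * p ^ j))
    hopen ((summable_geometric_of_lt_one (norm_nonneg p) hp).mul_left (‖a₀‖ + 1))
    (.of_forall fun j a ha => by
      rw [norm_neg, norm_mul, norm_pow]
      exact mul_le_mul_of_nonneg_right (by simpa using (mem_ball_zero_iff.1 ha).le)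
        (by positivity))
    (fun j => by fun_prop)
  have hd := hprod.differentiableOn (.of_forall fun s => by
    simpa [Finset.prod_fn] using DifferentiableOn.finsetProd (fun _ _ => by fun_prop)) hopen
  simpa only [qpoch, sub_eq_add_neg] using hd.differentiableAt (hopen.mem_nhds (by simp))

lemma theta_eq_one_sub_mul (hp : ‖p‖ < 1) (x : ℂ) :
    theta x p = (1 - x) * (qpoch (p * x) p * qpoch (p / x) p) := by
  rw [theta, qpoch_eq_one_sub_mul hp x, mul_assoc]

lemma theta_mul_left (hp : ‖p‖ < 1) (hp0 : p ≠ 0) {x : ℂ} (hx : x ≠ 0) :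
    theta (p * x) p = -x⁻¹ * theta x p := by
  have h : p / (p * x) = x⁻¹ := by field_simp
  rw [theta, h, qpoch_eq_one_sub_mul hp x⁻¹, theta_eq_one_sub_mul hp, ← div_eq_mul_inv p x]
  field_simp
  ring

lemma theta_eq_zero (hp : ‖p‖ < 1) {x : ℂ} (h : theta x p = 0) :
    (∃ j : ℕ, x * p ^ j = 1) ∨ ∃ j : ℕ, p / x * p ^ j = 1 := by
  by_contra! hne
  exact mul_ne_zero (qpoch_ne_zero hp hne.1) (qpoch_ne_zero hp hne.2) h

end Products

/-! ### The odd Jacobi theta function -/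

/-- A normalization of the odd Jacobi theta function in additive notation. -/
def oddTheta (u τ : ℂ) : ℂ :=
  cexp (-(Real.pi * I * u)) * theta (cexp (2 * Real.pi * I * u)) (cexp (2 * Real.pi * I * τ))

section OddTheta

variable {τ : ℂ}

lemma norm_nome_lt_one (hτ : 0 < τ.im) : ‖cexp (2 * Real.pi * I * τ)‖ < 1 := by
  simpa using UpperHalfPlane.norm_exp_two_pi_I_lt_one ⟨τ, hτ⟩

lemma theta_exp_eq (u τ : ℂ) :
    theta (cexp (2 * Real.pi * I * u)) (cexp (2 * Real.pi * I * τ)) =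
      cexp (Real.pi * I * u) * oddTheta u τ := by
  rw [oddTheta, ← mul_assoc, ← Complex.exp_add]
  simp

lemma differentiable_oddTheta (hτ : 0 < τ.im) : Differentiable ℂ fun u => oddTheta u τ := by
  have hq := differentiable_qpoch (norm_nome_lt_one hτ)
  refine Differentiable.mul (by fun_prop) (Differentiable.mul
    (hq.comp (g := fun a => qpoch a _) (by fun_prop)) (hq.comp (g := fun a => qpoch a _) ?_))
  exact (differentiable_const _).div (by fun_prop) fun u => Complex.exp_ne_zero _

lemma oddTheta_add_one (u τ : ℂ) : oddTheta (u + 1) τ = -oddTheta u τ := by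
  have h : cexp (2 * Real.pi * I * (u + 1)) = cexp (2 * Real.pi * I * u) := by
    rw [mul_add, mul_one, Complex.exp_periodic]
  have h' : cexp (-(Real.pi * I * (u + 1))) = -cexp (-(Real.pi * I * u)) := by
    rw [show -(Real.pi * I * (u + 1)) = -(Real.pi * I * u) - Real.pi * I by ring,
      Complex.exp_antiperiodic.sub_eq]
  rw [oddTheta, oddTheta, h, h', neg_mul]

lemma oddTheta_add_tau (hτ : 0 < τ.im) (u : ℂ) :
    oddTheta (u + τ) τ = -cexp (-(Real.pi * I * τ) - 2 * Real.pi * I * u) * oddTheta u τ := by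
  have h : cexp (2 * Real.pi * I * (u + τ)) =
      cexp (2 * Real.pi * I * τ) * cexp (2 * Real.pi * I * u) := by
    rw [← Complex.exp_add]; ring_nf
  rw [oddTheta, oddTheta, h,
    theta_mul_left (norm_nome_lt_one hτ) (Complex.exp_ne_zero _) (Complex.exp_ne_zero _),
    ← Complex.exp_neg, show -(Real.pi * I * (u + τ)) = -(Real.pi * I * u) + -(Real.pi * I * τ) by
      ring, Complex.exp_add, sub_eq_add_neg, Complex.exp_add]
  ring

lemma oddTheta_add_int (u τ : ℂ) (k : ℤ) :
    oddTheta (u + k) τ = cexp (Real.pi * I * k) * oddTheta u τ := by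
  have step : ∀ (k : ℤ), oddTheta (u + (k + 1 : ℤ)) τ = -oddTheta (u + k) τ := fun k => by
    push_cast; rw [← add_assoc, oddTheta_add_one]
  have estep : ∀ k : ℤ, cexp (Real.pi * I * (k + 1 : ℤ)) = -cexp (Real.pi * I * k) := fun k => by
    push_cast; rw [mul_add, mul_one, Complex.exp_antiperiodic]
  induction k using Int.induction_on with
  | zero => simp
  | succ k ih => rw [step, estep, ih, neg_mul]
  | pred k ih =>
    have h1 := step (-k - 1)
    have h2 := estep (-k - 1)
    rw [sub_add_cancel] at h1 h2
    rw [h1, h2] at ih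
    linear_combination -ih

lemma oddTheta_add_int_mul_tau (hτ : 0 < τ.im) (u : ℂ) (m : ℤ) :
    oddTheta (u + m * τ) τ =
      cexp (Real.pi * I * m - Real.pi * I * m ^ 2 * τ - 2 * Real.pi * I * m * u) *
        oddTheta u τ := by
  have step : ∀ m : ℤ, oddTheta (u + (m + 1 : ℤ) * τ) τ =
      -cexp (-(Real.pi * I * τ) - 2 * Real.pi * I * (u + m * τ)) * oddTheta (u + m * τ) τ :=
    fun m => by
      rw [← oddTheta_add_tau hτ]; push_cast; ring_nf
  have estep : ∀ m : ℤ, cexp (Real.pi * I * (m + 1 : ℤ) - Real.pi * I * (m + 1 : ℤ) ^ 2 * τ -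
        2 * Real.pi * I * (m + 1 : ℤ) * u) =
      -cexp (-(Real.pi * I * τ) - 2 * Real.pi * I * (u + m * τ)) *
        cexp (Real.pi * I * m - Real.pi * I * m ^ 2 * τ - 2 * Real.pi * I * m * u) := fun m => by
    rw [neg_mul, ← Complex.exp_add, ← Complex.exp_antiperiodic]
    push_cast; ring_nf
  induction m using Int.induction_on with
  | zero => simp
  | succ m ih => rw [step, estep, ih]; ring
  | pred m ih =>
    have h1 := step (-m - 1)
    have h2 := estep (-m - 1)
    rw [sub_add_cancel] at h1 h2
    rw [h1, h2, mul_assoc (-cexp _)] at ih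
    exact mul_left_cancel₀ (neg_ne_zero.2 (Complex.exp_ne_zero _)) ih

lemma oddTheta_add_lattice (hτ : 0 < τ.im) (u : ℂ) (m k : ℤ) :
    oddTheta (u + (m * τ + k)) τ =
      cexp (Real.pi * I * (m + k) - Real.pi * I * m ^ 2 * τ - 2 * Real.pi * I * m * u) *
        oddTheta u τ := by
  rw [← add_assoc, oddTheta_add_int, oddTheta_add_int_mul_tau hτ, ← mul_assoc, ← Complex.exp_add]
  ring_nf

lemma oddTheta_zero (hτ : 0 < τ.im) : oddTheta 0 τ = 0 := by
  simp [oddTheta, theta_eq_one_sub_mul (norm_nome_lt_one hτ)]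

lemma oddTheta_lattice (hτ : 0 < τ.im) (m k : ℤ) : oddTheta (m * τ + k) τ = 0 := by
  simpa [oddTheta_zero hτ] using oddTheta_add_lattice hτ 0 m k

lemma exists_lattice_of_oddTheta_eq_zero (hτ : 0 < τ.im) {u : ℂ} (h : oddTheta u τ = 0) :
    ∃ m k : ℤ, u = m * τ + k := by
  have key : ∀ (v : ℂ) (j : ℕ),
      cexp (2 * Real.pi * I * v) * cexp (2 * Real.pi * I * τ) ^ j = 1 →
        ∃ k : ℤ, v + j * τ = k := fun v j hj => by
    rw [← Complex.exp_nat_mul, ← Complex.exp_add, Complex.exp_eq_one_iff] at hj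
    obtain ⟨k, hk⟩ := hj
    exact ⟨k, mul_left_cancel₀ Complex.two_pi_I_ne_zero (by linear_combination hk)⟩
  rcases theta_eq_zero (norm_nome_lt_one hτ)
    ((mul_eq_zero.1 h).resolve_left (Complex.exp_ne_zero _)) with ⟨j, hj⟩ | ⟨j, hj⟩
  · obtain ⟨k, hk⟩ := key u j hj
    exact ⟨-j, k, by push_cast; linear_combination hk⟩
  · rw [← Complex.exp_sub, ← mul_sub] at hj
    obtain ⟨k, hk⟩ := key (τ - u) j hj
    exact ⟨j + 1, -k, by push_cast; linear_combination -hk⟩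

lemma deriv_oddTheta_zero_ne_zero (hτ : 0 < τ.im) : deriv (fun u => oddTheta u τ) 0 ≠ 0 := by
  have hp := norm_nome_lt_one hτ
  set p := cexp (2 * Real.pi * I * τ) with hpdef
  have hq := differentiable_qpoch hp
  let R : ℂ → ℂ := fun u => cexp (-(Real.pi * I * u)) *
    (qpoch (p * cexp (2 * Real.pi * I * u)) p * qpoch (p / cexp (2 * Real.pi * I * u)) p)
  have hR : Differentiable ℂ R := by
    refine Differentiable.mul (by fun_prop) (Differentiable.mul
      (hq.comp (g := fun a => qpoch a _) (by fun_prop)) (hq.comp (g := fun a => qpoch a _) ?_))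
    exact (differentiable_const _).div (by fun_prop) fun u => Complex.exp_ne_zero _
  have hne : qpoch p p ≠ 0 := qpoch_ne_zero hp fun j hj => by
    have : ‖p * p ^ j‖ < 1 := by
      rw [← pow_succ', norm_pow]
      exact pow_lt_one₀ (norm_nonneg _) hp (by simp)
    simp [hj] at this
  have hR0 : R 0 ≠ 0 := by simp [R, hne]
  have heq : (fun u => oddTheta u τ) = (fun u => 1 - cexp (2 * Real.pi * I * u)) * R := by
    funext u
    rw [oddTheta, ← hpdef, theta_eq_one_sub_mul hp]
    simp only [R, Pi.mul_apply]
    ring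
  have hE : HasDerivAt (fun u : ℂ => 1 - cexp (2 * Real.pi * I * u)) (-(2 * Real.pi * I)) 0 := by
    have := (((hasDerivAt_id (0 : ℂ)).const_mul (2 * Real.pi * I)).cexp).const_sub 1
    simpa using this
  have hderiv := (hE.mul (hR 0).hasDerivAt).deriv
  rw [heq]
  refine hderiv.trans_ne ?_
  simpa using hR0

lemma exists_oddTheta_ne_zero (hτ : 0 < τ.im) : ∃ u, oddTheta u τ ≠ 0 := by
  by_contra! h
  exact deriv_oddTheta_zero_ne_zero hτ (by simp [h])

lemma deriv_oddTheta_lattice_ne_zero (hτ : 0 < τ.im) (m k : ℤ) :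
    deriv (fun u => oddTheta u τ) (m * τ + k) ≠ 0 := by
  intro h0
  set w : ℂ := m * τ + k with hw
  let E : ℂ → ℂ := fun u =>
    cexp (Real.pi * I * (m + k) - Real.pi * I * m ^ 2 * τ - 2 * Real.pi * I * m * u)
  have hE : Differentiable ℂ E := by fun_prop
  have hθ := differentiable_oddTheta hτ
  have h1 : HasDerivAt (fun u => oddTheta (u + w) τ) 0 0 := by
    have h := (hθ w).hasDerivAt
    rw [h0] at h
    exact HasDerivAt.comp_add_const 0 w (by simpa using h)
  have h2 := (hE 0).hasDerivAt.mul (hθ 0).hasDerivAt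
  have heq : (fun u => oddTheta (u + w) τ) = E * fun u => oddTheta u τ := by
    funext u
    exact oddTheta_add_lattice hτ u m k
  rw [← heq] at h2
  have h3 := h1.unique h2
  rw [oddTheta_zero hτ, mul_zero, zero_add] at h3
  exact mul_ne_zero (Complex.exp_ne_zero _) (deriv_oddTheta_zero_ne_zero hτ) h3.symm

end OddTheta

/-! ### Modular transformations -/

section Modular

variable {a b c d : ℤ} {τ : ℂ}

lemma denom_ne_zero_of_det (hdet : a * d - b * c = 1) (hτ : 0 < τ.im) :
    (c * τ + d : ℂ) ≠ 0 := by
  intro h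
  have him := congrArg Complex.im h
  have hre := congrArg Complex.re h
  simp at him hre
  have hc : c = 0 := him.resolve_right hτ.ne'
  have hd : d = 0 := by simpa [hc] using hre
  simp [hc, hd] at hdet

lemma im_mobius_pos (hdet : a * d - b * c = 1) (hτ : 0 < τ.im) :
    0 < ((a * τ + b) / (c * τ + d) : ℂ).im := by
  have hdet' : (a * d - b * c : ℝ) = 1 := mod_cast hdet
  have him : ((a * τ + b) / (c * τ + d) : ℂ).im = τ.im / Complex.normSq (c * τ + d) := by
    rw [Complex.div_im]
    simp
    linear_combination (τ.im / Complex.normSq (c * τ + d)) * hdet'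
  rw [him]
  exact div_pos hτ (Complex.normSq_pos.2 (denom_ne_zero_of_det hdet hτ))

lemma cexp_pi_mul_I_mul_of_even {m : ℤ} (hm : m % 2 = 0) : cexp (Real.pi * I * m) = 1 := by
  obtain ⟨k, rfl⟩ := Int.dvd_of_emod_eq_zero hm
  exact Complex.exp_eq_one_iff.2 ⟨k, by push_cast; ring⟩

lemma cexp_pi_mul_I_mul_of_odd {m : ℤ} (hm : m % 2 = 1) : cexp (Real.pi * I * m) = -1 := by
  rw [show m = (m - 1) + 1 by ring]
  push_cast
  rw [mul_add, mul_one, Complex.exp_antiperiodic]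
  have := cexp_pi_mul_I_mul_of_even (m := m - 1) (by omega)
  push_cast at this
  rw [this]

theorem oddTheta_modular (hdet : a * d - b * c = 1) (ha : a % 2 = 1) (hb : b % 2 = 0)
    (hc : c % 2 = 0) (hd : d % 2 = 1) (hτ : 0 < τ.im) :
    ∃ C : ℂ, C ≠ 0 ∧ ∀ u, oddTheta (u / (c * τ + d)) ((a * τ + b) / (c * τ + d)) =
      C * (cexp (Real.pi * I * c * u ^ 2 / (c * τ + d)) * oddTheta u τ) := by
  have hj := denom_ne_zero_of_det hdet hτ
  have hτ' := im_mobius_pos hdet hτ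
  have hdet' : (a * d - b * c : ℂ) = 1 := mod_cast hdet
  set j : ℂ := c * τ + d with hjdef
  set τ' : ℂ := (a * τ + b) / j with hmob
  have hjτ' : j * τ' = a * τ + b := by rw [hmob]; field_simp
  have hone : 1 / j = (-c : ℤ) * τ' + a := by
    push_cast
    field_simp
    linear_combination c * hjτ' - hdet' - a * hjdef
  have htau : τ / j = d * τ' + (-b : ℤ) := by
    push_cast
    field_simp
    linear_combination -d * hjτ' - τ * hdet' + b * hjdef
  let f : ℂ → ℂ := fun u => cexp (-(Real.pi * I * c * u ^ 2 / j)) * oddTheta (u / j) τ'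
  have hf : Differentiable ℂ f := Differentiable.mul (by fun_prop)
    ((differentiable_oddTheta hτ').comp (g := fun u => oddTheta u τ') (by fun_prop))
  have hf1 : ∀ u, f (u + 1) = -1 * f u := fun u => by
    simp only [f]
    have hsign := cexp_pi_mul_I_mul_of_odd (m := a - c - a * c) (by
      have : a * c % 2 = 0 := by simp [Int.mul_emod, hc]
      omega)
    rw [add_div u, hone, oddTheta_add_lattice hτ', ← hsign, ← mul_assoc, ← mul_assoc,
      ← Complex.exp_add, ← Complex.exp_add]
    congr 2
    push_cast at hone ⊢
    linear_combination -(Real.pi * I * c) * hone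
  have hf2 : ∀ u, f (u + τ) = -cexp (-(Real.pi * I * τ) - 2 * Real.pi * I * u) * f u := fun u => by
    simp only [f]
    have hsign := cexp_pi_mul_I_mul_of_odd (m := d - b - b * d) (by
      have : b * d % 2 = 0 := by simp [Int.mul_emod, hb]
      omega)
    have hinv : (c * τ + d) / j = 1 := div_self hj
    rw [add_div u, htau, oddTheta_add_lattice hτ',
      ← neg_one_mul (cexp (-(Real.pi * I * τ) - 2 * Real.pi * I * u)), ← hsign, ← mul_assoc,
      ← mul_assoc, ← Complex.exp_add, ← Complex.exp_add, ← Complex.exp_add]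
    congr 2
    push_cast at htau ⊢
    linear_combination Real.pi * I * (d * htau - (2 * u + τ) * hinv)
  obtain ⟨C, hC⟩ := exists_eq_const_mul hτ hf (differentiable_oddTheta hτ)
    (exists_oddTheta_ne_zero hτ) (fun u hu => by
      obtain ⟨m, k, rfl⟩ := exists_lattice_of_oddTheta_eq_zero hτ hu
      refine ⟨?_, deriv_oddTheta_lattice_ne_zero hτ m k⟩
      have : (m * τ + k) / j = (m * d - k * c : ℤ) * τ' + (k * a - m * b : ℤ) := by
        rw [add_div, mul_div_assoc, htau, div_eq_mul_one_div (k : ℂ), hone]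
        push_cast
        ring
      simp only [f]
      rw [this, oddTheta_lattice hτ', mul_zero])
    hf1 (fun u => by rw [oddTheta_add_one, neg_one_mul]) hf2 (oddTheta_add_tau hτ)
  have hC' : ∀ u, oddTheta (u / j) τ' =
      C * (cexp (Real.pi * I * c * u ^ 2 / j) * oddTheta u τ) := fun u => by
    rw [mul_left_comm, ← hC, ← mul_assoc, ← Complex.exp_add]
    simp
  refine ⟨C, fun h0 => ?_, hC'⟩
  obtain ⟨u, hu⟩ := exists_oddTheta_ne_zero hτ'
  have := hC' (j * u)
  rw [mul_div_cancel_left₀ _ hj, h0, zero_mul] at this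
  exact hu this

/-- The even theta function obtained from `oddTheta` by translation by the half-period `1 / 2`. -/
def thetaTwo (u τ : ℂ) : ℂ := oddTheta (u + 1 / 2) τ

/-- The even theta function obtained from `oddTheta` by translation by the half-period `τ / 2`. -/
def thetaFour (u τ : ℂ) : ℂ := cexp (Real.pi * I * u) * oddTheta (u + τ / 2) τ

theorem thetaTwo_modular (hdet : a * d - b * c = 1) (ha : a % 2 = 1) (hb : b % 2 = 0)
    (hc : c % 2 = 0) (hd : d % 2 = 1) (hτ : 0 < τ.im) :
    ∃ C : ℂ, C ≠ 0 ∧ ∀ u, thetaTwo (u / (c * τ + d)) ((a * τ + b) / (c * τ + d)) =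
      C * (cexp (Real.pi * I * c * u ^ 2 / (c * τ + d)) * thetaTwo u τ) := by
  have hj := denom_ne_zero_of_det hdet hτ
  obtain ⟨C, hC0, hC⟩ := oddTheta_modular hdet ha hb hc hd hτ
  obtain ⟨m, rfl⟩ := Int.dvd_of_emod_eq_zero hc
  obtain ⟨k, rfl⟩ : ∃ k, d = 2 * k + 1 := ⟨d / 2, by omega⟩
  set j : ℂ := (2 * m : ℤ) * τ + (2 * k + 1 : ℤ) with hjdef
  refine ⟨C * cexp (Real.pi * I * m * j / 2 + Real.pi * I * (m + k) - Real.pi * I * m ^ 2 * τ -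
    Real.pi * I * m), mul_ne_zero hC0 (Complex.exp_ne_zero _), fun u => ?_⟩
  have h1 : u / j + 1 / 2 = (u + j / 2) / j := by field_simp
  have h2 : u + j / 2 = u + 1 / 2 + (m * τ + k) := by rw [hjdef]; push_cast; ring
  have h3 := oddTheta_add_lattice hτ (u + 1 / 2) m k
  rw [← h2] at h3
  rw [thetaTwo, thetaTwo, h1, hC, h3, mul_assoc C, ← mul_assoc (cexp _), ← mul_assoc (cexp _),
    ← Complex.exp_add, ← Complex.exp_add]
  congr 3
  push_cast
  field_simp
  ring

theorem thetaFour_modular (hdet : a * d - b * c = 1) (ha : a % 2 = 1) (hb : b % 2 = 0)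
    (hc : c % 2 = 0) (hd : d % 2 = 1) (hτ : 0 < τ.im) :
    ∃ C : ℂ, C ≠ 0 ∧ ∀ u, thetaFour (u / (c * τ + d)) ((a * τ + b) / (c * τ + d)) =
      C * (cexp (Real.pi * I * c * u ^ 2 / (c * τ + d)) * thetaFour u τ) := by
  have hj := denom_ne_zero_of_det hdet hτ
  have hdet' : (a * d - b * c : ℂ) = 1 := mod_cast hdet
  obtain ⟨C, hC0, hC⟩ := oddTheta_modular hdet ha hb hc hd hτ
  obtain ⟨m, rfl⟩ : ∃ m, a = 2 * m + 1 := ⟨a / 2, by omega⟩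
  obtain ⟨k, rfl⟩ := Int.dvd_of_emod_eq_zero hb
  set j : ℂ := c * τ + d with hjdef
  set s : ℂ := ((2 * m + 1 : ℤ) * τ + (2 * k : ℤ)) with hsdef
  have hs : c * s + 1 = (2 * m + 1) * j := by
    rw [hjdef, hsdef]; push_cast at hdet' ⊢; linear_combination -hdet'
  refine ⟨C * cexp (Real.pi * I * c * s ^ 2 / (4 * j) + Real.pi * I * (m + k) -
    Real.pi * I * m ^ 2 * τ - Real.pi * I * m * τ),
    mul_ne_zero hC0 (Complex.exp_ne_zero _), fun u => ?_⟩
  have h1 : u / j + s / j / 2 = (u + s / 2) / j := by field_simp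
  have h2 : u + s / 2 = u + τ / 2 + (m * τ + k) := by rw [hsdef]; push_cast; ring
  have h3 := oddTheta_add_lattice hτ (u + τ / 2) m k
  rw [← h2] at h3
  rw [thetaFour, thetaFour, h1, hC, h3, mul_assoc C, mul_left_comm (cexp _) C]
  simp only [← mul_assoc (cexp _), ← Complex.exp_add]
  congr 3
  field_simp
  linear_combination (16 * u) * hs

end Modular

/-! ### Pfaffians of theta functions -/

lemma pf_const_mul {m : ℕ} (K : ℂ) (A : Matrix (Fin (2 * m)) (Fin (2 * m)) ℂ) :
    pf (fun i j => K * A i j) = K ^ m * pf A := by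
  simp only [pf, Finset.prod_mul_distrib, Finset.prod_const, Finset.card_univ, Fintype.card_fin,
    Finset.mul_sum]
  refine Finset.sum_congr rfl fun σ _ => ?_
  ring

/-- The common shape of `P1` and `P3`: a product over pairs times a pfaffian, both built from
functions of differences of the variables. -/
def pairPf (n : ℕ) (F E : ℂ → ℂ) (z : Fin (2 * n) → ℂ) : ℂ :=
  (∏ i, ∏ j, if i < j then F (z i - z j) else 1) * pf (fun i j => E (z i - z j))

lemma pairPf_transform (n : ℕ) {F F' E E' : ℂ → ℂ} {D K κ w : ℂ}
    (hF : ∀ u, F' (u / w) = D * (cexp (κ * u ^ 2) * F u)) (hE : ∀ u, E' (u / w) = K * E u)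
    (z : Fin (2 * n) → ℂ) :
    pairPf n F' E' (fun i => z i / w) =
      (∏ i : Fin (2 * n), ∏ j : Fin (2 * n), if i < j then D else 1) * K ^ n *
        cexp (κ * ∑ i, ∑ j, if i < j then (z i - z j) ^ 2 else 0) * pairPf n F E z := by
  have hprod : (∏ i, ∏ j, if i < j then F' (z i / w - z j / w) else 1) =
      (∏ i : Fin (2 * n), ∏ j : Fin (2 * n), if i < j then D else 1) *
        (cexp (κ * ∑ i, ∑ j, if i < j then (z i - z j) ^ 2 else 0) *
          ∏ i, ∏ j, if i < j then F (z i - z j) else 1) := by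
    simp only [Finset.mul_sum, Complex.exp_sum, ← Finset.prod_mul_distrib]
    refine Finset.prod_congr rfl fun i _ => Finset.prod_congr rfl fun j _ => ?_
    split_ifs
    · rw [← sub_div, hF]
    · simp
  have hpf : pf (fun i j => E' (z i / w - z j / w)) = K ^ n * pf (fun i j => E (z i - z j)) := by
    refine Eq.trans (congrArg pf ?_) (pf_const_mul K _)
    funext i j
    rw [← sub_div, hE]
  simp only [pairPf]
  rw [hprod, hpf]
  ring

/-- The numerator of the pfaffian entries. -/
def entryNum (u τ : ℂ) : ℂ := oddTheta u τ * thetaTwo u τ * thetaFour u τ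

lemma entryNum_modular {a b c d : ℤ} {τ : ℂ} (hdet : a * d - b * c = 1) (ha : a % 2 = 1)
    (hb : b % 2 = 0) (hc : c % 2 = 0) (hd : d % 2 = 1) (hτ : 0 < τ.im) :
    ∃ C : ℂ, ∀ u, entryNum (u / (c * τ + d)) ((a * τ + b) / (c * τ + d)) =
      C * (cexp (3 * Real.pi * I * c / (c * τ + d) * u ^ 2) * entryNum u τ) := by
  obtain ⟨C₁, -, h₁⟩ := oddTheta_modular hdet ha hb hc hd hτ
  obtain ⟨C₂, -, h₂⟩ := thetaTwo_modular hdet ha hb hc hd hτ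
  obtain ⟨C₄, -, h₄⟩ := thetaFour_modular hdet ha hb hc hd hτ
  refine ⟨C₁ * C₂ * C₄, fun u => ?_⟩
  have h : cexp (3 * Real.pi * I * c / (c * τ + d) * u ^ 2) =
      cexp (Real.pi * I * c * u ^ 2 / (c * τ + d)) ^ 3 := by
    rw [← Complex.exp_nat_mul]
    push_cast
    ring_nf
  rw [entryNum, entryNum, h₁, h₂, h₄, h]
  ring

lemma xOf_div (z w : ℂ) : xOf z / xOf w = cexp (Real.pi * I * (z - w)) := by
  rw [xOf, xOf, ← Complex.exp_sub, mul_sub]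

lemma xOf_pow_div_pow (z w : ℂ) (k : ℕ) :
    xOf z ^ k / xOf w ^ k = cexp (Real.pi * I * (k * (z - w))) := by
  rw [← div_pow, xOf_div, ← Complex.exp_nat_mul]
  ring_nf

lemma pPow_eq (τ lam : ℂ) : pPow τ lam = cexp (2 * Real.pi * I * (lam * τ / 2)) := by
  rw [pPow]; ring_nf

lemma theta_exp_eq' {v τ x p : ℂ} (hx : x = cexp (2 * Real.pi * I * v))
    (hp : p = cexp (2 * Real.pi * I * τ)) :
    theta x p = cexp (Real.pi * I * v) * oddTheta v τ := by
  rw [hx, hp, theta_exp_eq]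

lemma theta_neg_exp_eq {v τ x p : ℂ} (hx : x = cexp (2 * Real.pi * I * v))
    (hp : p = cexp (2 * Real.pi * I * τ)) :
    theta (-x) p = I * cexp (Real.pi * I * v) * thetaTwo v τ := by
  have h : -x = cexp (2 * Real.pi * I * (v + 1 / 2)) := by
    rw [hx, ← Complex.exp_antiperiodic]; ring_nf
  have h' : cexp (Real.pi * I * (v + 1 / 2)) = I * cexp (Real.pi * I * v) := by
    rw [show Real.pi * I * (v + 1 / 2) = Real.pi / 2 * I + Real.pi * I * v by ring,
      Complex.exp_add, Complex.exp_pi_div_two_mul_I]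
  rw [theta_exp_eq' h hp, h', thetaTwo]

lemma theta_numerator_eq (u τ : ℂ) :
    theta (cexp (Real.pi * I * (2 * u))) (pPow τ 2) *
      theta (-cexp (Real.pi * I * (2 * u))) (pPow τ 2) *
      theta (pPow τ 1 * cexp (Real.pi * I * (2 * u))) (pPow τ 2) =
      I * cexp (Real.pi * I * τ / 2) * cexp (Real.pi * I * (2 * u)) * entryNum u τ := by
  have hx : cexp (Real.pi * I * (2 * u)) = cexp (2 * Real.pi * I * u) := by ring_nf
  have hp : pPow τ 2 = cexp (2 * Real.pi * I * τ) := by rw [pPow_eq]; ring_nf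
  have hxp : pPow τ 1 * cexp (Real.pi * I * (2 * u)) = cexp (2 * Real.pi * I * (u + τ / 2)) := by
    rw [pPow_eq, ← Complex.exp_add]; ring_nf
  have h2 : cexp (Real.pi * I * (2 * u)) = cexp (Real.pi * I * u) * cexp (Real.pi * I * u) := by
    rw [← Complex.exp_add]; ring_nf
  have h4 : cexp (Real.pi * I * (u + τ / 2)) =
      cexp (Real.pi * I * u) * cexp (Real.pi * I * τ / 2) := by
    rw [← Complex.exp_add]; ring_nf
  rw [theta_exp_eq' hx hp, theta_neg_exp_eq hx hp, theta_exp_eq' hxp hp, h2, h4, entryNum,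
    thetaFour]
  ring

/-- The pfaffian entries, with denominator `thetaTwo (s * u) σ`. -/
def entry (s σ τ u : ℂ) : ℂ := cexp (Real.pi * I * τ / 2) * entryNum u τ / thetaTwo (s * u) σ

lemma P1_eq (n : ℕ) (τ : ℂ) (z : Fin (2 * n) → ℂ) :
    P1 n τ z = pairPf n (fun u => I * thetaTwo (3 * u) (3 * τ)) (entry 3 (3 * τ) τ) z := by
  have hp : pPow τ 6 = cexp (2 * Real.pi * I * (3 * τ)) := by rw [pPow_eq]; ring_nf
  have hden : ∀ u, theta (-cexp (Real.pi * I * (6 * u))) (pPow τ 6) =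
      I * cexp (Real.pi * I * (3 * u)) * thetaTwo (3 * u) (3 * τ) := fun u =>
    theta_neg_exp_eq (by ring_nf) hp
  simp only [P1, pairPf]
  congr 1
  · refine Finset.prod_congr rfl fun i _ => Finset.prod_congr rfl fun j _ => ?_
    split_ifs
    · rw [xOf_pow_div_pow, xOf_pow_div_pow, Nat.cast_ofNat, Nat.cast_ofNat, hden, ← mul_assoc,
        mul_left_comm, ← Complex.exp_add]
      ring_nf
      simp
    · rfl
  · congr 1
    funext i j
    rw [xOf_pow_div_pow, xOf_pow_div_pow, xOf_div, Nat.cast_ofNat, Nat.cast_ofNat, mul_assoc,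
      mul_assoc (cexp _), ← mul_assoc (theta _ _), theta_numerator_eq, hden, entry]
    have h3 : cexp (Real.pi * I * (3 * (z i - z j))) =
        cexp (Real.pi * I * (z i - z j)) * cexp (Real.pi * I * (2 * (z i - z j))) := by
      rw [← Complex.exp_add]; ring_nf
    rw [h3]
    have e1 := Complex.exp_ne_zero (Real.pi * I * (z i - z j))
    have e2 := Complex.exp_ne_zero (Real.pi * I * (2 * (z i - z j)))
    field_simp

lemma P3_eq (n : ℕ) (τ : ℂ) (z : Fin (2 * n) → ℂ) :
    P3 n τ z = pairPf n (fun u => I * thetaTwo u (τ / 3)) (entry 1 (τ / 3) τ) z := by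
  have hp : pPow τ (2 / 3) = cexp (2 * Real.pi * I * (τ / 3)) := by rw [pPow_eq]; ring_nf
  have hden : ∀ u, theta (-cexp (Real.pi * I * (2 * u))) (pPow τ (2 / 3)) =
      I * cexp (Real.pi * I * u) * thetaTwo u (τ / 3) := fun u =>
    theta_neg_exp_eq (by ring_nf) hp
  simp only [P3, pairPf]
  congr 1
  · refine Finset.prod_congr rfl fun i _ => Finset.prod_congr rfl fun j _ => ?_
    split_ifs
    · rw [xOf_pow_div_pow, xOf_div, Nat.cast_ofNat, hden, ← mul_assoc,
        mul_left_comm, ← Complex.exp_add]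
      ring_nf
      simp
    · rfl
  · congr 1
    funext i j
    rw [xOf_pow_div_pow, xOf_div, Nat.cast_ofNat, mul_assoc,
      mul_assoc (cexp _), ← mul_assoc (theta _ _), theta_numerator_eq, hden, entry, one_mul]
    have h1 : cexp (Real.pi * I * (z j - z i)) * cexp (Real.pi * I * (2 * (z i - z j))) =
        cexp (Real.pi * I * (z i - z j)) := by
      rw [← Complex.exp_add]; ring_nf
    rw [show ∀ A B C D : ℂ, A * (I * B * C * D) = (A * C) * (I * B * D) by intros; ring, h1]
    have e1 := Complex.exp_ne_zero (Real.pi * I * (z i - z j))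
    field_simp

lemma entry_transform {s s' σ σ' τ τ' κ w D K : ℂ} (hD : D ≠ 0)
    (hden : ∀ u, thetaTwo (s' * (u / w)) σ' = D * (cexp (κ * u ^ 2) * thetaTwo (s * u) σ))
    (hnum : ∀ u, entryNum (u / w) τ' = K * (cexp (κ * u ^ 2) * entryNum u τ)) (u : ℂ) :
    entry s' σ' τ' (u / w) =
      cexp (Real.pi * I * τ' / 2 - Real.pi * I * τ / 2) * K / D * entry s σ τ u := by
  have h1 := Complex.exp_ne_zero (κ * u ^ 2)
  have h2 := Complex.exp_ne_zero (Real.pi * I * τ / 2)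
  rw [entry, entry, hden, hnum, Complex.exp_sub]
  rcases eq_or_ne (thetaTwo (s * u) σ) 0 with h | h
  · simp [h]
  · field_simp

theorem stmt0 (n : ℕ) (hn : 1 ≤ n) (a b c d : ℤ) (hdet : a * d - b * c = 1)
    (ha : a % 2 = 1) (hb : b % 2 = 0) (hc : c % 2 = 0) (hd : d % 2 = 1)
    (τ : ℂ) (hτ : 0 < τ.im) :
    ((3 : ℤ) ∣ c → ∃ C : ℂ, ∀ z : Fin (2 * n) → ℂ,
      P1 n ((a * τ + b) / (c * τ + d)) (fun i => z i / (c * τ + d)) =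
        C * Complex.exp (3 * Real.pi * Complex.I * c / (c * τ + d) *
          ∑ i, ∑ j, if i < j then (z i - z j) ^ 2 else 0) * P1 n τ z) ∧
    ((3 : ℤ) ∣ d → ∃ C : ℂ, ∀ z : Fin (2 * n) → ℂ,
      P1 n ((a * τ + b) / (c * τ + d)) (fun i => z i / (c * τ + d)) =
        C * Complex.exp (3 * Real.pi * Complex.I * c / (c * τ + d) *
          ∑ i, ∑ j, if i < j then (z i - z j) ^ 2 else 0) * P3 n τ z) := by
  obtain ⟨K, hK⟩ := entryNum_modular hdet ha hb hc hd hτ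
  constructor
  · rintro ⟨e, rfl⟩
    obtain ⟨D, hD0, hD⟩ := thetaTwo_modular (a := a) (b := 3 * b) (c := e) (d := d) (τ := 3 * τ)
      (by linear_combination hdet) ha (by omega) (by omega) hd (by simpa using hτ)
    have hden : ∀ u, thetaTwo (3 * (u / ((3 * e : ℤ) * τ + d)))
        (3 * ((a * τ + b) / ((3 * e : ℤ) * τ + d))) =
        D * (cexp (3 * Real.pi * I * (3 * e : ℤ) / ((3 * e : ℤ) * τ + d) * u ^ 2) *
          thetaTwo (3 * u) (3 * τ)) := fun u => by
      have h := hD (3 * u)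
      rw [show (e * (3 * τ) + d : ℂ) = (3 * e : ℤ) * τ + d by push_cast; ring] at h
      rw [← mul_div_assoc, ← mul_div_assoc,
        show (3 * (a * τ + b) : ℂ) = a * (3 * τ) + (3 * b : ℤ) by push_cast; ring, h]
      push_cast
      ring_nf
    have htransform := pairPf_transform n
      (F := fun u => I * thetaTwo (3 * u) (3 * τ)) (F' := fun u => I * thetaTwo (3 * u) (3 * _))
      (fun u => by
        rw [hden u, mul_left_comm I, mul_left_comm I]) (entry_transform hD0 hden hK)
    exact ⟨_, fun z => (P1_eq n _ _).trans
      ((htransform z).trans (congrArg _ (P1_eq n τ z).symm))⟩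
  · rintro ⟨e, rfl⟩
    obtain ⟨D, hD0, hD⟩ := thetaTwo_modular (a := 3 * a) (b := b) (c := c) (d := e) (τ := τ / 3)
      (by linear_combination hdet) (by omega) hb hc (by omega) (by simpa using hτ)
    have hden : ∀ u, thetaTwo (3 * (u / (c * τ + (3 * e : ℤ))))
        (3 * ((a * τ + b) / (c * τ + (3 * e : ℤ)))) =
        D * (cexp (3 * Real.pi * I * c / (c * τ + (3 * e : ℤ)) * u ^ 2) *
          thetaTwo (1 * u) (τ / 3)) := fun u => by
      have h := hD u
      rw [show (c * (τ / 3) + e : ℂ) = (c * τ + (3 * e : ℤ)) / 3 by push_cast; ring,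
        div_div_eq_mul_div, div_div_eq_mul_div, div_div_eq_mul_div] at h
      rw [one_mul, show 3 * (u / (c * τ + (3 * e : ℤ))) = u * 3 / (c * τ + (3 * e : ℤ)) by ring,
        show 3 * ((a * τ + b) / (c * τ + (3 * e : ℤ))) =
          ((3 * a : ℤ) * (τ / 3) + b) * 3 / (c * τ + (3 * e : ℤ)) by push_cast; ring, h]
      ring_nf
    have htransform := pairPf_transform n
      (F := fun u => I * thetaTwo u (τ / 3)) (F' := fun u => I * thetaTwo (3 * u) (3 * _))
      (fun u => by
        rw [hden u, one_mul, mul_left_comm I, mul_left_comm I]) (entry_transform hD0 hden hK)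
    exact ⟨_, fun z => (P1_eq n _ _).trans
      ((htransform z).trans (congrArg _ (P3_eq n τ z).symm))⟩

end
end

section
/- Let n≥1 and let f:ℂ→ℂ be an odd entire function. Then, as z₁,…,z_{2n} tend to 0 through pairwise distinct values, the quotient Pf_{1≤i,j≤2n}(f(z_i−z_j)) / ∏_{1≤i<j≤2n}(z_i−z_j) converges, and its limit equals det_{1≤i,j≤n}(f^{(2i+2j−3)}(0)) / ∏_{j=1}^{2n}(j−1)!. -/
open Complex BigOperators Finset

noncomputable section

section PairedSum

variable {α R : Type*} [Fintype α] [DecidableEq α] [CommRing R]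

/-- The unnormalized pfaffian of a matrix whose indices come in pairs `(inl j, inr j)`. -/
def pairedSum (A : Matrix (α ⊕ α) (α ⊕ α) R) : R :=
  ∑ σ : Equiv.Perm (α ⊕ α), ((Equiv.Perm.sign σ : ℤ) : R) *
    ∏ j, A (σ (Sum.inl j)) (σ (Sum.inr j))

theorem pairedSum_congr_eq_sum_det (V D : Matrix (α ⊕ α) (α ⊕ α) R) :
    pairedSum (V * D * V.transpose) = ∑ p : α → (α ⊕ α) × (α ⊕ α),
      (∏ j, D (p j).1 (p j).2) *
        (V.submatrix id (Sum.elim (fun j => (p j).1) (fun j => (p j).2))).det := by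
  have entry (i k : α ⊕ α) : (V * D * V.transpose) i k =
      ∑ q : (α ⊕ α) × (α ⊕ α), D q.1 q.2 * (V i q.1 * V k q.2) := by
    simp only [Matrix.mul_apply, Matrix.transpose_apply, Finset.sum_mul, Fintype.sum_prod_type]
    rw [Finset.sum_comm]
    refine Finset.sum_congr rfl fun a _ => Finset.sum_congr rfl fun b _ => ?_
    ring
  simp only [pairedSum, entry, Finset.prod_univ_sum, Fintype.piFinset_univ, Finset.mul_sum]
  rw [Finset.sum_comm]
  refine Finset.sum_congr rfl fun p _ => ?_
  rw [Matrix.det_apply', Finset.mul_sum]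
  refine Finset.sum_congr rfl fun σ _ => ?_
  simp only [Fintype.prod_sum_type, Finset.prod_mul_distrib, Matrix.submatrix_apply, id,
    Sum.elim_inl, Sum.elim_inr]
  ring

theorem pairedSum_congr (V D : Matrix (α ⊕ α) (α ⊕ α) R) :
    pairedSum (V * D * V.transpose) = V.det * pairedSum D := by
  have h := pairedSum_congr_eq_sum_det 1 D
  rw [Matrix.transpose_one, Matrix.one_mul, Matrix.mul_one] at h
  rw [h, pairedSum_congr_eq_sum_det, Finset.mul_sum]
  refine Finset.sum_congr rfl fun p _ => ?_
  have (g : α ⊕ α → α ⊕ α) :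
      V.submatrix id g = V * (1 : Matrix (α ⊕ α) (α ⊕ α) R).submatrix id g := by
    ext i j
    simp [Matrix.mul_apply, Matrix.one_apply]
  rw [this, Matrix.det_mul]
  ring

theorem pairedSum_sub_transpose (A : Matrix (α ⊕ α) (α ⊕ α) R) :
    pairedSum (A - A.transpose) = 2 ^ Fintype.card α * pairedSum A := by
  have key (s : Finset α) : ∑ σ : Equiv.Perm (α ⊕ α), ((Equiv.Perm.sign σ : ℤ) : R) *
      ∏ j, (if j ∈ s then A - A.transpose else A) (σ (Sum.inl j)) (σ (Sum.inr j)) =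
      2 ^ s.card * pairedSum A := by
    induction s using Finset.induction_on with
    | empty => simp [pairedSum]
    | insert a s ha ih =>
      rw [Finset.card_insert_of_notMem ha, pow_succ, mul_right_comm, ← ih, mul_two]
      set X : α → Matrix (α ⊕ α) (α ⊕ α) R := fun j => if j ∈ s then A - A.transpose else A
        with hX
      have split (σ : Equiv.Perm (α ⊕ α)) :
          ∏ j, (if j ∈ insert a s then A - A.transpose else A) (σ (Sum.inl j)) (σ (Sum.inr j)) =
          ∏ j, X j (σ (Sum.inl j)) (σ (Sum.inr j)) -
          ∏ j, X j ((σ * Equiv.swap (Sum.inl a) (Sum.inr a)) (Sum.inl j))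
            ((σ * Equiv.swap (Sum.inl a) (Sum.inr a)) (Sum.inr j)) := by
        have fix (j : α) (hj : j ∈ Finset.univ.erase a) :
            (if j ∈ insert a s then A - A.transpose else A) (σ (Sum.inl j)) (σ (Sum.inr j)) =
              X j (σ (Sum.inl j)) (σ (Sum.inr j)) := by
          simp [hX, Finset.ne_of_mem_erase hj]
        have fix' (j : α) (hj : j ∈ Finset.univ.erase a) :
            X j ((σ * Equiv.swap (Sum.inl a) (Sum.inr a)) (Sum.inl j))
              ((σ * Equiv.swap (Sum.inl a) (Sum.inr a)) (Sum.inr j)) =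
              X j (σ (Sum.inl j)) (σ (Sum.inr j)) := by
          have hne := Finset.ne_of_mem_erase hj
          rw [Equiv.Perm.mul_apply, Equiv.Perm.mul_apply,
            Equiv.swap_apply_of_ne_of_ne (by simpa using hne) (by simp),
            Equiv.swap_apply_of_ne_of_ne (by simp) (by simpa using hne)]
        rw [← Finset.mul_prod_erase _ _ (Finset.mem_univ a),
          ← Finset.mul_prod_erase _ _ (Finset.mem_univ a),
          ← Finset.mul_prod_erase _ _ (Finset.mem_univ a),
          Finset.prod_congr rfl fix, Finset.prod_congr rfl fix', ← sub_mul]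
        simp [hX, ha]
      simp only [split, mul_sub, Finset.sum_sub_distrib]
      rw [sub_eq_add_neg, ← Finset.sum_neg_distrib]
      congr 1
      refine Fintype.sum_equiv (Equiv.mulRight (Equiv.swap (Sum.inl a) (Sum.inr a))) _ _ fun σ => ?_
      simp [hX]
  simpa [pairedSum] using key Finset.univ

theorem pairedSum_fromBlocks (M : Matrix α α R) :
    pairedSum (Matrix.fromBlocks 0 M 0 0) = (Fintype.card α).factorial * M.det := by
  have h : pairedSum (Matrix.fromBlocks 0 M 0 0) =
      ∑ q : Equiv.Perm α × Equiv.Perm α, ((Equiv.Perm.sign q.1 : ℤ) : R) *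
        (((Equiv.Perm.sign q.2 : ℤ) : R) * ∏ j, M (q.1 j) (q.2 j)) := by
    symm
    refine Finset.sum_of_injOn (fun q => Equiv.sumCongr q.1 q.2)
      (Equiv.Perm.sumCongrHom_injective (α := α) (β := α)).injOn (by simp) ?_ ?_
    · intro σ _ hσ
      have h1 : ¬∀ x, ∃ y, Sum.inl y = σ (Sum.inl x) := by
        intro hall
        obtain ⟨q, hq⟩ := Equiv.Perm.mem_sumCongrHom_range_of_perm_mapsTo_inl (σ := σ) (by
          rintro _ ⟨x, rfl⟩
          exact hall x)
        exact hσ ⟨q, by simp, hq⟩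
      obtain ⟨a, ha⟩ := not_forall.mp h1
      rw [Finset.prod_eq_zero (Finset.mem_univ a), mul_zero]
      rcases hx : σ (Sum.inl a) with b | b
      · exact absurd ⟨b, hx.symm⟩ ha
      · rcases σ (Sum.inr a) with c | c <;> simp
    · rintro ⟨σ, τ⟩ _
      simp [Equiv.Perm.sign_sumCongr, mul_assoc]
  have inner (σ : Equiv.Perm α) :
      ∑ τ : Equiv.Perm α, ((Equiv.Perm.sign τ : ℤ) : R) * ∏ j, M (σ j) (τ j) =
        ((Equiv.Perm.sign σ : ℤ) : R) * M.det := by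
    rw [← Matrix.det_permute, ← Matrix.det_transpose, Matrix.det_apply']
    rfl
  rw [h, Fintype.sum_prod_type]
  simp only [← Finset.mul_sum, inner]
  simp only [← mul_assoc, ← Int.cast_mul, ← Units.val_mul, Int.units_mul_self]
  simp [Fintype.card_perm]

end PairedSum

/-- Splitting of `Fin (2 * m)` into even and odd indices. -/
def evenOddEquiv (m : ℕ) : Fin m ⊕ Fin m ≃ Fin (2 * m) where
  toFun := Sum.elim (fun j => ⟨2 * (j : ℕ), by omega⟩) (fun j => ⟨2 * (j : ℕ) + 1, by omega⟩)
  invFun i := if (i : ℕ) % 2 = 0 then Sum.inl ⟨i / 2, by omega⟩ else Sum.inr ⟨i / 2, by omega⟩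
  left_inv := by
    rintro (j | j)
    · simp
    · have : (2 * (j : ℕ) + 1) % 2 = 1 := by omega
      have h2 : (2 * (j : ℕ) + 1) / 2 = j := by omega
      simp [this, h2]
  right_inv i := by
    rcases Nat.mod_two_eq_zero_or_one i with h | h
    · ext; simp [h]; omega
    · ext; simp [h]; omega

theorem pf_eq_pairedSum {m : ℕ} (A : Matrix (Fin (2 * m)) (Fin (2 * m)) ℂ) :
    pf A = 1 / (2 ^ m * (Nat.factorial m) : ℂ) *
      pairedSum (A.submatrix (evenOddEquiv m) (evenOddEquiv m)) := by
  unfold pf pairedSum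
  congr 1
  symm
  refine Fintype.sum_equiv (evenOddEquiv m).permCongr _ _ fun σ => ?_
  rw [Equiv.Perm.sign_permCongr]
  congr 1
  refine Finset.prod_congr rfl fun j _ => ?_
  have h0 : (⟨2 * (j : ℕ), by omega⟩ : Fin (2 * m)) = evenOddEquiv m (Sum.inl j) := rfl
  have h1 : (⟨2 * (j : ℕ) + 1, by omega⟩ : Fin (2 * m)) = evenOddEquiv m (Sum.inr j) := rfl
  rw [h0, h1]
  simp [Equiv.permCongr_apply]

theorem pf_congr {m : ℕ} (V D : Matrix (Fin (2 * m)) (Fin (2 * m)) ℂ) :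
    pf (V * D * V.transpose) = V.det * pf D := by
  rw [pf_eq_pairedSum, pf_eq_pairedSum, ← Matrix.submatrix_mul_equiv _ _ _ (evenOddEquiv m),
    ← Matrix.submatrix_mul_equiv _ _ _ (evenOddEquiv m), ← Matrix.transpose_submatrix,
    pairedSum_congr, Matrix.det_submatrix_equiv_self]
  ring

theorem pf_eq_det {m : ℕ} (A : Matrix (Fin (2 * m)) (Fin (2 * m)) ℂ) (M : Matrix (Fin m) (Fin m) ℂ)
    (h : A.submatrix (evenOddEquiv m) (evenOddEquiv m) =
      Matrix.fromBlocks 0 M (-M.transpose) 0) : pf A = M.det := by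
  have hs : (Matrix.fromBlocks 0 M (-M.transpose) 0 : Matrix (Fin m ⊕ Fin m) (Fin m ⊕ Fin m) ℂ) =
      Matrix.fromBlocks 0 M 0 0 - (Matrix.fromBlocks 0 M 0 0).transpose := by
    ext (i | i) (j | j) <;> simp
  rw [pf_eq_pairedSum, h, hs, pairedSum_sub_transpose, pairedSum_fromBlocks, Fintype.card_fin]
  have : (Nat.factorial m : ℂ) ≠ 0 := by exact_mod_cast m.factorial_ne_zero
  field_simp

/-- Prepend a zero to a sequence. -/
def shiftSeq (b : ℕ → ℂ) : ℕ → ℂ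
  | 0 => 0
  | k + 1 => b k

theorem sum_shiftSeq_mul (b v : ℕ → ℂ) (N : ℕ) (hv : v N = 0) :
    ∑ k ∈ Finset.range N, shiftSeq b k * v k = ∑ k ∈ Finset.range N, b k * v (k + 1) := by
  have h1 := Finset.sum_range_succ (fun k => shiftSeq b k * v k) N
  have h2 := Finset.sum_range_succ' (fun k => shiftSeq b k * v k) N
  simp only [hv, mul_zero, add_zero] at h1
  simp only [shiftSeq, zero_mul, add_zero] at h2
  exact h1.symm.trans h2

/-- The Newton basis polynomials with nodes `z`, evaluated at `x`, up to sign. -/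
def newtonBasis (z : ℕ → ℂ) (x : ℂ) (k : ℕ) : ℂ := ∏ l ∈ Finset.range k, (z l - x)

/-- The coefficients of `(x - y) ^ m` in the products of Newton basis polynomials, modulo the
polynomials vanishing at all nodes. -/
def newtonCoeff (z : ℕ → ℂ) : ℕ → ℕ → ℕ → ℂ
  | 0, k, l => if k = 0 ∧ l = 0 then 1 else 0
  | m + 1, k, l => (z k - z l) * newtonCoeff z m k l - shiftSeq (fun i => newtonCoeff z m i l) k +
      shiftSeq (fun j => newtonCoeff z m k j) l

theorem sum_newtonCoeff (z : ℕ → ℂ) (N : ℕ) (hN : 0 < N) (x y : ℂ)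
    (hx : newtonBasis z x N = 0) (hy : newtonBasis z y N = 0) (m : ℕ) :
    ∑ k ∈ Finset.range N, ∑ l ∈ Finset.range N,
      newtonCoeff z m k l * newtonBasis z x k * newtonBasis z y l = (x - y) ^ m := by
  induction m with
  | zero =>
    rw [Finset.sum_eq_single_of_mem 0 (by simpa using hN),
      Finset.sum_eq_single_of_mem 0 (by simpa using hN)]
    · simp [newtonCoeff, newtonBasis]
    · intro l _ hl
      simp [newtonCoeff, hl]
    · intro k _ hk
      simp [newtonCoeff, hk]
  | succ m ih =>
    have step (u : ℂ) (k : ℕ) : newtonBasis z u (k + 1) = (z k - u) * newtonBasis z u k := by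
      rw [newtonBasis, Finset.prod_range_succ, mul_comm, newtonBasis]
    have h1 : ∑ k ∈ Finset.range N, ∑ l ∈ Finset.range N,
        shiftSeq (fun i => newtonCoeff z m i l) k * newtonBasis z x k * newtonBasis z y l =
        ∑ k ∈ Finset.range N, ∑ l ∈ Finset.range N,
          newtonCoeff z m k l * newtonBasis z x (k + 1) * newtonBasis z y l := by
      rw [Finset.sum_comm]
      conv_rhs => rw [Finset.sum_comm]
      refine Finset.sum_congr rfl fun l _ => ?_
      rw [← Finset.sum_mul, ← Finset.sum_mul, sum_shiftSeq_mul _ _ _ hx]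
    have h2 : ∑ k ∈ Finset.range N, ∑ l ∈ Finset.range N,
        shiftSeq (fun j => newtonCoeff z m k j) l * newtonBasis z x k * newtonBasis z y l =
        ∑ k ∈ Finset.range N, ∑ l ∈ Finset.range N,
          newtonCoeff z m k l * newtonBasis z x k * newtonBasis z y (l + 1) := by
      refine Finset.sum_congr rfl fun k _ => ?_
      simp only [mul_right_comm _ (newtonBasis z x k)]
      rw [← Finset.sum_mul, ← Finset.sum_mul, sum_shiftSeq_mul _ _ _ hy]
    simp only [newtonCoeff, add_mul, sub_mul, Finset.sum_add_distrib, Finset.sum_sub_distrib]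
    rw [h1, h2, pow_succ, ← ih]
    simp only [← Finset.sum_add_distrib, ← Finset.sum_sub_distrib, Finset.sum_mul, step]
    refine Finset.sum_congr rfl fun k _ => Finset.sum_congr rfl fun l _ => ?_
    ring

theorem newtonCoeff_zero (m k l : ℕ) :
    newtonCoeff 0 m k l = if k + l = m then (-1) ^ k * ((k + l).choose k : ℂ) else 0 := by
  induction m generalizing k l with
  | zero =>
    rcases k with _ | k <;> simp [newtonCoeff]
  | succ m ih =>
    rcases k with _ | k <;> rcases l with _ | l
    · simp [newtonCoeff, shiftSeq]
    · simp [newtonCoeff, shiftSeq, ih]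
    · simp [newtonCoeff, shiftSeq, ih, pow_succ]
      split_ifs <;> simp
    · simp only [newtonCoeff, shiftSeq, ih, Pi.zero_apply, sub_self, zero_mul, zero_sub]
      have e1 : (k + (l + 1) = m) ↔ (k + 1 + (l + 1) = m + 1) := by omega
      have e2 : (k + 1 + l = m) ↔ (k + 1 + (l + 1) = m + 1) := by omega
      simp only [e1, e2]
      split_ifs with h
      · have : (k + 1 + (l + 1)).choose (k + 1) =
            (k + (l + 1)).choose k + (k + 1 + l).choose (k + 1) := by
          rw [show k + 1 + (l + 1) = (k + (l + 1)) + 1 by ring, Nat.choose_succ_succ,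
            show k + 1 + l = k + (l + 1) by ring]
        rw [this]
        push_cast
        ring
      · simp

theorem norm_newtonCoeff_le (z : ℕ → ℂ) (hz : ∀ k, ‖z k‖ ≤ 1) (m k l : ℕ) :
    ‖newtonCoeff z m k l‖ ≤ 4 ^ m := by
  have shift_le (b : ℕ → ℂ) (C : ℝ) (hC : 0 ≤ C) (hb : ∀ i, ‖b i‖ ≤ C) (i : ℕ) :
      ‖shiftSeq b i‖ ≤ C := by
    cases i with
    | zero => simpa [shiftSeq] using hC
    | succ i => exact hb i
  induction m generalizing k l with
  | zero =>
    simp only [newtonCoeff]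
    split_ifs <;> simp
  | succ m ih =>
    have h1 := shift_le (fun i => newtonCoeff z m i l) (4 ^ m) (by positivity) (fun i => ih i l) k
    have h2 := shift_le (fun j => newtonCoeff z m k j) (4 ^ m) (by positivity) (fun j => ih k j) l
    have h3 : ‖(z k - z l) * newtonCoeff z m k l‖ ≤ 2 * 4 ^ m := by
      rw [norm_mul]
      refine mul_le_mul ?_ (ih k l) (norm_nonneg _) (by norm_num)
      exact (norm_sub_le _ _).trans (by linarith [hz k, hz l])
    calc ‖newtonCoeff z (m + 1) k l‖ ≤ _ := (norm_add_le _ _).trans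
          (add_le_add_left (norm_sub_le _ _) _)
      _ ≤ 2 * 4 ^ m + 4 ^ m + 4 ^ m := by gcongr
      _ = 4 ^ (m + 1) := by ring

theorem continuous_newtonCoeff {X : Type*} [TopologicalSpace X] (z : X → ℕ → ℂ)
    (hz : ∀ k, Continuous fun t => z t k) (m k l : ℕ) :
    Continuous fun t => newtonCoeff (z t) m k l := by
  have shift_cont (b : X → ℕ → ℂ) (hb : ∀ i, Continuous fun t => b t i) (i : ℕ) :
      Continuous fun t => shiftSeq (b t) i := by
    cases i with
    | zero => exact continuous_const
    | succ i => exact hb i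
  induction m generalizing k l with
  | zero => exact continuous_const
  | succ m ih =>
    exact ((((hz k).sub (hz l)).mul (ih k l)).sub (shift_cont _ (fun i => ih i l) k)).add
      (shift_cont _ (fun j => ih k j) l)

theorem iteratedDeriv_even_eq_zero_of_odd (f : ℂ → ℂ) (hodd : ∀ z : ℂ, f (-z) = -f z) (m : ℕ)
    (hm : Even m) : iteratedDeriv m f 0 = 0 := by
  have h := iteratedDeriv_comp_neg m f 0
  simp only [hodd, neg_zero, hm.neg_one_pow, one_smul] at h
  rw [iteratedDeriv_fun_neg] at h
  exact self_eq_neg.mp h.symm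

theorem continuous_pf {m : ℕ} :
    Continuous (pf : Matrix (Fin (2 * m)) (Fin (2 * m)) ℂ → ℂ) := by
  unfold pf
  fun_prop

/-- Extension of a finite tuple by zero. -/
def zeroExtend {N : ℕ} (z : Fin N → ℂ) (k : ℕ) : ℂ := if h : k < N then z ⟨k, h⟩ else 0

theorem zeroExtend_fin {N : ℕ} (z : Fin N → ℂ) (k : Fin N) : zeroExtend z k = z k := by
  simp [zeroExtend]

theorem norm_zeroExtend_le {N : ℕ} (z : Fin N → ℂ) (k : ℕ) : ‖zeroExtend z k‖ ≤ ‖z‖ := by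
  unfold zeroExtend
  split_ifs
  · exact norm_le_pi_norm _ _
  · simp

theorem newtonBasis_node_eq_zero {N : ℕ} (z : Fin N → ℂ) (i : Fin N) (k : ℕ) (h : (i : ℕ) < k) :
    newtonBasis (zeroExtend z) (z i) k = 0 :=
  Finset.prod_eq_zero (Finset.mem_range.2 h) (by rw [zeroExtend_fin, sub_self])

theorem det_newtonBasis {N : ℕ} (z : Fin N → ℂ) :
    (Matrix.of fun i k : Fin N => newtonBasis (zeroExtend z) (z i) k).det =
      ∏ i, ∏ j, if i < j then z i - z j else 1 := by
  rw [Matrix.det_of_isLowerTriangular _ fun i j hij => by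
    exact newtonBasis_node_eq_zero z i j (by simpa using hij), Finset.prod_comm]
  refine Finset.prod_congr rfl fun j _ => ?_
  have h := Fin.prod_univ_eq_prod_range
    (fun l => if l < (j : ℕ) then zeroExtend z l - z j else 1) N
  simp only [zeroExtend_fin, Fin.val_fin_lt] at h
  rw [h, Matrix.of_apply, newtonBasis, ← Finset.prod_filter]
  refine Finset.prod_congr ?_ fun _ _ => rfl
  ext l
  simp only [Finset.mem_range, Finset.mem_filter]
  omega

/-- The matrix of coefficients of `f (x - y)` in products of Newton basis polynomials. -/
def newtonMatrix (f : ℂ → ℂ) {N : ℕ} (z : Fin N → ℂ) : Matrix (Fin N) (Fin N) ℂ :=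
  Matrix.of fun k l => ∑' m : ℕ,
    ((m.factorial : ℂ)⁻¹ * iteratedDeriv m f 0) * newtonCoeff (zeroExtend z) m k l

theorem summable_norm_taylorCoeff_mul_pow (f : ℂ → ℂ) (hf : Differentiable ℂ f) :
    Summable fun m : ℕ => ‖(m.factorial : ℂ)⁻¹ * iteratedDeriv m f 0‖ * (4 : ℝ) ^ m := by
  have h := (Complex.hasSum_taylorSeries_of_entire hf 0 4).summable.norm
  refine h.congr fun m => ?_
  simp only [sub_zero, smul_eq_mul, norm_mul, norm_pow, Complex.norm_ofNat]
  ring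

theorem eq_newtonMatrix_congr (f : ℂ → ℂ) (hf : Differentiable ℂ f) {N : ℕ} (hN : 0 < N)
    (z : Fin N → ℂ) (hz : ‖z‖ ≤ 1) :
    (Matrix.of fun i j => f (z i - z j)) =
      (Matrix.of fun i k : Fin N => newtonBasis (zeroExtend z) (z i) k) * newtonMatrix f z *
      (Matrix.of fun i k : Fin N => newtonBasis (zeroExtend z) (z i) k).transpose := by
  ext i j
  have hsum (k l : ℕ) : Summable fun m : ℕ =>
      ((m.factorial : ℂ)⁻¹ * iteratedDeriv m f 0) * newtonCoeff (zeroExtend z) m k l := by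
    refine Summable.of_norm_bounded (summable_norm_taylorCoeff_mul_pow f hf) fun m => ?_
    rw [norm_mul]
    gcongr
    exact norm_newtonCoeff_le _ (fun k => (norm_zeroExtend_le z k).trans hz) m k l
  have h1 := hasSum_sum (s := Finset.range N) fun k _ => hasSum_sum (s := Finset.range N) fun l _ =>
    (hsum k l).hasSum.mul_right
      (newtonBasis (zeroExtend z) (z i) k * newtonBasis (zeroExtend z) (z j) l)
  have h2 := Complex.hasSum_taylorSeries_of_entire hf 0 (z i - z j)
  rw [Matrix.of_apply, h2.unique (h1.congr_fun fun m => ?_)]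
  · simp only [Matrix.mul_apply, Matrix.transpose_apply, Finset.sum_mul, Matrix.of_apply,
      newtonMatrix]
    rw [Finset.sum_comm, ← Fin.sum_univ_eq_sum_range (fun l => ∑ k ∈ Finset.range N, _)]
    refine Finset.sum_congr rfl fun l _ => ?_
    rw [← Fin.sum_univ_eq_sum_range]
    refine Finset.sum_congr rfl fun k _ => ?_
    ring
  · rw [sub_zero, ← sum_newtonCoeff (zeroExtend z) N hN _ _
      (newtonBasis_node_eq_zero z i N i.isLt) (newtonBasis_node_eq_zero z j N j.isLt) m]
    simp only [smul_eq_mul, Finset.sum_mul, Finset.mul_sum]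
    refine Finset.sum_congr rfl fun k _ => Finset.sum_congr rfl fun l _ => ?_
    ring

theorem newtonMatrix_zero_apply (f : ℂ → ℂ) {N : ℕ} (k l : Fin N) :
    newtonMatrix f (0 : Fin N → ℂ) k l =
      (-1) ^ (k : ℕ) * iteratedDeriv (k + l) f 0 /
        ((Nat.factorial k : ℂ) * Nat.factorial l) := by
  have h0 : zeroExtend (0 : Fin N → ℂ) = 0 := by
    ext k
    simp [zeroExtend]
  rw [newtonMatrix, Matrix.of_apply, tsum_eq_single ((k : ℕ) + l)]
  · rw [h0, newtonCoeff_zero, if_pos rfl, Nat.cast_add_choose]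
    have h1 : (((k : ℕ) + l).factorial : ℂ) ≠ 0 := by exact_mod_cast Nat.factorial_ne_zero _
    field_simp
  · intro m hm
    rw [h0, newtonCoeff_zero, if_neg hm.symm, mul_zero]

theorem tendsto_newtonMatrix (f : ℂ → ℂ) (hf : Differentiable ℂ f) (N : ℕ) :
    Filter.Tendsto (fun z : Fin N → ℂ => newtonMatrix f z) (nhds 0) (nhds (newtonMatrix f 0)) := by
  refine tendsto_pi_nhds.2 fun k => tendsto_pi_nhds.2 fun l => ?_
  refine tendsto_tsum_of_dominated_convergence (summable_norm_taylorCoeff_mul_pow f hf) ?_ ?_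
  · intro m
    refine (continuous_const.mul (continuous_newtonCoeff _ (fun k => ?_) m k l)).tendsto 0
    unfold zeroExtend
    split_ifs
    · exact continuous_apply _
    · exact continuous_const
  · filter_upwards [Metric.closedBall_mem_nhds (0 : Fin N → ℂ) one_pos] with z hz m
    rw [norm_mul]
    gcongr
    exact norm_newtonCoeff_le _ (fun k => (norm_zeroExtend_le z k).trans (by simpa using hz)) m k l

theorem pf_newtonMatrix_zero (n : ℕ) (f : ℂ → ℂ) (hodd : ∀ z : ℂ, f (-z) = -f z) :
    pf (newtonMatrix f (0 : Fin (2 * n) → ℂ)) =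
      Matrix.det (Matrix.of fun i j : Fin n =>
          iteratedDeriv (2 * (i : ℕ) + 2 * (j : ℕ) + 1) f 0) /
        ∏ j ∈ Finset.range (2 * n), (Nat.factorial j : ℂ) := by
  set B : Matrix (Fin (2 * n)) (Fin (2 * n)) ℂ :=
    Matrix.of fun k l => (-1) ^ (k : ℕ) * iteratedDeriv (k + l) f 0 with hB
  have hfac : newtonMatrix f (0 : Fin (2 * n) → ℂ) =
      Matrix.diagonal (fun k : Fin (2 * n) => (Nat.factorial k : ℂ)⁻¹) * B *
        (Matrix.diagonal (fun k : Fin (2 * n) => (Nat.factorial k : ℂ)⁻¹)).transpose := by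
    ext k l
    rw [newtonMatrix_zero_apply, Matrix.diagonal_transpose, Matrix.mul_diagonal,
      Matrix.diagonal_mul, hB, Matrix.of_apply, div_eq_mul_inv, mul_inv]
    ring
  rw [hfac, pf_congr, Matrix.det_diagonal, Finset.prod_inv_distrib,
    Fin.prod_univ_eq_prod_range (fun j => (Nat.factorial j : ℂ)), div_eq_inv_mul]
  congr 1
  refine pf_eq_det _ _ ?_
  ext (i | i) (j | j)
  · simp only [hB, evenOddEquiv, Matrix.submatrix_apply, Equiv.coe_fn_mk, Sum.elim_inl,
      Matrix.of_apply, Matrix.fromBlocks_apply₁₁, Matrix.zero_apply]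
    rw [iteratedDeriv_even_eq_zero_of_odd f hodd _ ⟨i + j, by ring⟩, mul_zero]
  · simp [hB, evenOddEquiv, pow_mul, add_assoc]
  · simp only [hB, evenOddEquiv, Matrix.submatrix_apply, Equiv.coe_fn_mk, Sum.elim_inl,
      Sum.elim_inr, Matrix.of_apply, Matrix.fromBlocks_apply₂₁, Matrix.neg_apply,
      Matrix.transpose_apply]
    rw [pow_succ, pow_mul, show 2 * (i : ℕ) + 1 + 2 * j = 2 * j + 2 * i + 1 by ring]
    simp
  · simp only [hB, evenOddEquiv, Matrix.submatrix_apply, Equiv.coe_fn_mk, Sum.elim_inr,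
      Matrix.of_apply, Matrix.fromBlocks_apply₂₂, Matrix.zero_apply]
    rw [iteratedDeriv_even_eq_zero_of_odd f hodd _ ⟨i + j + 1, by ring⟩, mul_zero]

theorem stmt14 (n : ℕ) (hn : 1 ≤ n) (f : ℂ → ℂ) (hf : Differentiable ℂ f)
    (hodd : ∀ z : ℂ, f (-z) = -f z) :
    Filter.Tendsto
      (fun z : Fin (2 * n) → ℂ =>
        pf (fun i j => f (z i - z j)) / ∏ i, ∏ j, if i < j then z i - z j else 1)
      (nhdsWithin 0 {z : Fin (2 * n) → ℂ | Function.Injective z})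
      (nhds (Matrix.det (Matrix.of fun i j : Fin n =>
          iteratedDeriv (2 * (i : ℕ) + 2 * (j : ℕ) + 1) f 0) /
        ∏ j ∈ Finset.range (2 * n), (Nat.factorial j : ℂ))) := by
  rw [← pf_newtonMatrix_zero n f hodd]
  refine (((continuous_pf.tendsto _).comp (tendsto_newtonMatrix f hf (2 * n))).mono_left
    nhdsWithin_le_nhds).congr' ?_
  filter_upwards [self_mem_nhdsWithin,
    mem_nhdsWithin_of_mem_nhds (Metric.closedBall_mem_nhds (0 : Fin (2 * n) → ℂ) one_pos)]
    with z hinj hz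
  have hprod : (∏ i, ∏ j, if i < j then z i - z j else 1) ≠ 0 := by
    refine Finset.prod_ne_zero_iff.2 fun i _ => Finset.prod_ne_zero_iff.2 fun j _ => ?_
    split_ifs with hij
    · exact sub_ne_zero.2 fun h => hij.ne (hinj h)
    · exact one_ne_zero
  have h := pf_congr (Matrix.of fun i k : Fin (2 * n) => newtonBasis (zeroExtend z) (z i) k)
    (newtonMatrix f z)
  rw [← eq_newtonMatrix_congr f hf (by omega) z (by simpa using hz), det_newtonBasis] at h
  rw [Function.comp_apply, eq_div_iff hprod, mul_comm]
  exact h.symm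

end
end
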